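/- (The 'beautiful bit'.) Let P be a Markov kernel on a measurable space X reversible with respect to a probability measure π, with κ*_P := inf { κ*_P(A) : A measurable, 0 < π(A) < 1 }. Then for every nonnegative measurable function h : X → [0,∞) with ∫ h dπ < ∞: ∬ π(dx) P(x,dy) |h(y) − h(x)| ≥ κ*_P · ∬ π(dx) π(dy) |h(y) − h(x)|. -/

import Mathlib

open MeasureTheory ProbabilityTheory

/-- A layer-cake formula for the positive part of an increment. -/
theorem lintegral_ofReal_sub_eq_lintegral_superlevel {X : Type*} [MeasurableSpace X]
    (m : Measure (X × X)) [SFinite m] {g : X → ℝ} (hg : Measurable g) :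
    ∫⁻ p, ENNReal.ofReal (g p.1 - g p.2) ∂m
      = ∫⁻ t : ℝ, m ({x | t < g x} ×ˢ {x | t < g x}ᶜ) := by
  have hS : MeasurableSet {q : (X × X) × ℝ | g q.1.2 ≤ q.2 ∧ q.2 < g q.1.1} :=
    (measurableSet_le (f := fun q : (X × X) × ℝ => g q.1.2) (by fun_prop) measurable_snd).inter
      (measurableSet_lt (g := fun q : (X × X) × ℝ => g q.1.1) measurable_snd (by fun_prop))
  calc ∫⁻ p, ENNReal.ofReal (g p.1 - g p.2) ∂m
      = ∫⁻ p, volume (Set.Ico (g p.2) (g p.1)) ∂m := by simp_rw [Real.volume_Ico]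
    _ = (m.prod volume) {q : (X × X) × ℝ | g q.1.2 ≤ q.2 ∧ q.2 < g q.1.1} :=
        (Measure.prod_apply hS).symm
    _ = ∫⁻ t : ℝ, m ({x | t < g x} ×ˢ {x | t < g x}ᶜ) := by
        rw [Measure.prod_apply_symm hS]
        congr! 3 with t
        ext p
        simp [and_comm]

/-- A co-area formula: the total variation of a function against a symmetric measure is twice
the integral of the flows out of its superlevel sets. -/
theorem lintegral_abs_sub_eq_two_mul_lintegral_superlevel {X : Type*} [MeasurableSpace X]
    (m : Measure (X × X)) [SFinite m] (hm : m.map Prod.swap = m)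
    {g : X → ℝ} (hg : Measurable g) :
    ∫⁻ p, ENNReal.ofReal |g p.2 - g p.1| ∂m
      = 2 * ∫⁻ t : ℝ, m ({x | t < g x} ×ˢ {x | t < g x}ᶜ) := by
  have hsplit (a b : ℝ) :
      ENNReal.ofReal |b - a| = ENNReal.ofReal (a - b) + ENNReal.ofReal (b - a) := by
    rcases le_total a b with hab | hab
    · rw [abs_of_nonneg (by linarith), ENNReal.ofReal_of_nonpos (p := a - b) (by linarith),
        zero_add]
    · rw [abs_of_nonpos (by linarith), ENNReal.ofReal_of_nonpos (p := b - a) (by linarith),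
        add_zero, neg_sub]
  have hswap : ∫⁻ p, ENNReal.ofReal (g p.2 - g p.1) ∂m
      = ∫⁻ p, ENNReal.ofReal (g p.1 - g p.2) ∂m := by
    conv_rhs => rw [← hm]
    rw [lintegral_map (by fun_prop) measurable_swap]
    rfl
  simp_rw [hsplit]
  rw [lintegral_add_left (by fun_prop), hswap,
    lintegral_ofReal_sub_eq_lintegral_superlevel m hg, two_mul]

/-- An isoperimetric inequality for all measurable sets implies the corresponding
inequality for the total variation of integrable functions. -/
theorem mul_integral_abs_sub_le_of_flow_le {X : Type*} [MeasurableSpace X]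
    (π : Measure X) [IsProbabilityMeasure π] (m : Measure (X × X)) [SFinite m]
    (hm : m.map Prod.swap = m) (hfst : m.fst = π) (κ : ℝ) (hκ : 0 ≤ κ)
    (hflow : ∀ A, MeasurableSet A → ENNReal.ofReal κ * (π A * π Aᶜ) ≤ m (A ×ˢ Aᶜ))
    {h : X → ℝ} (hint : Integrable h π) :
    κ * ∫ p, |h p.2 - h p.1| ∂(π.prod π) ≤ ∫ p, |h p.2 - h p.1| ∂m := by
  have hsnd : m.snd = π := by
    rw [← hfst]
    conv_rhs => rw [← hm]
    rw [Measure.fst_map_swap]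
  have hmfst : MeasurePreserving Prod.fst m π := ⟨measurable_fst, hfst⟩
  have hmsnd : MeasurePreserving Prod.snd m π := ⟨measurable_snd, hsnd⟩
  obtain ⟨g, hgm, hgh⟩ := hint.aemeasurable
  have hcongr (μ : Measure (X × X)) (h₁ : MeasurePreserving Prod.fst μ π)
      (h₂ : MeasurePreserving Prod.snd μ π) :
      (fun p : X × X => |h p.2 - h p.1|) =ᵐ[μ] fun p => |g p.2 - g p.1| := by
    filter_upwards [h₁.quasiMeasurePreserving.ae hgh, h₂.quasiMeasurePreserving.ae hgh]
      with p hp₁ hp₂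
    rw [hp₁, hp₂]
  have hgint : Integrable g π := hint.congr hgh
  have hgm_int : Integrable (fun p : X × X => |g p.2 - g p.1|) m :=
    ((hmsnd.integrable_comp_of_integrable hgint).sub
      (hmfst.integrable_comp_of_integrable hgint)).abs
  rw [integral_congr_ae (hcongr m hmfst hmsnd),
    integral_congr_ae (hcongr (π.prod π) measurePreserving_fst measurePreserving_snd),
    integral_eq_lintegral_of_nonneg_ae (.of_forall fun _ => abs_nonneg _)
      (by fun_prop : Measurable fun p : X × X => |g p.2 - g p.1|).aestronglyMeasurable,
    integral_eq_lintegral_of_nonneg_ae (.of_forall fun _ => abs_nonneg _)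
      (by fun_prop : Measurable fun p : X × X => |g p.2 - g p.1|).aestronglyMeasurable]
  nth_rewrite 1 [← ENNReal.toReal_ofReal hκ]
  rw [← ENNReal.toReal_mul]
  refine ENNReal.toReal_mono hgm_int.lintegral_lt_top.ne ?_
  rw [lintegral_abs_sub_eq_two_mul_lintegral_superlevel m hm hgm,
    lintegral_abs_sub_eq_two_mul_lintegral_superlevel (π.prod π) Measure.prod_swap hgm,
    mul_left_comm, ← lintegral_const_mul' _ _ ENNReal.ofReal_ne_top]
  gcongr with t
  rw [Measure.prod_prod]
  exact hflow _ (measurableSet_lt measurable_const hgm)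

/-- The 'beautiful bit'. For a Markov kernel `P` reversible with respect to a probability
measure `π`, with `κ*_P = inf {κ*_P(A) : 0 < π(A) < 1}`, every nonnegative measurable
`h` with `∫ h dπ < ∞` satisfies
`∬ π(dx) P(x,dy) |h(y) − h(x)| ≥ κ*_P ∬ π(dx) π(dy) |h(y) − h(x)|`. -/
theorem cheeger_beautiful_bit
    {X : Type*} [MeasurableSpace X]
    (π : Measure X) [IsProbabilityMeasure π]
    (P : Kernel X X) [IsMarkovKernel P]
    (hrev : (π ⊗ₘ P).map Prod.swap = π ⊗ₘ P)
    (κstar : ℝ)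
    (hκstar : κstar = sInf {r : ℝ | ∃ A : Set X, MeasurableSet A ∧ 0 < π A ∧ π A < 1 ∧
      r = ((π ⊗ₘ P) (A ×ˢ Aᶜ)).toReal / ((π A).toReal * (π Aᶜ).toReal)})
    (h : X → ℝ) (h_nonneg : ∀ x, 0 ≤ h x) (h_int : Integrable h π) :
    ∫ p : X × X, |h p.2 - h p.1| ∂(π ⊗ₘ P)
      ≥ κstar * ∫ p : X × X, |h p.2 - h p.1| ∂(π.prod π) := by
  set S := {r : ℝ | ∃ A : Set X, MeasurableSet A ∧ 0 < π A ∧ π A < 1 ∧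
      r = ((π ⊗ₘ P) (A ×ˢ Aᶜ)).toReal / ((π A).toReal * (π Aᶜ).toReal)} with hS
  have hS_nonneg : ∀ r ∈ S, 0 ≤ r := by
    rintro r ⟨A, -, -, -, rfl⟩
    positivity
  have hκ : 0 ≤ κstar := hκstar ▸ Real.sInf_nonneg hS_nonneg
  refine mul_integral_abs_sub_le_of_flow_le π (π ⊗ₘ P) hrev (Measure.fst_compProd π P) κstar hκ
    (fun A hA => ?_) h_int
  rcases eq_or_ne (π A) 0 with h0 | h0
  · simp [h0]
  rcases eq_or_ne (π Aᶜ) 0 with h1 | h1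
  · simp [h1]
  have hlt : π A < 1 :=
    prob_le_one.lt_of_ne fun hA1 => h1 ((prob_compl_eq_zero_iff hA).2 hA1)
  have hle : κstar ≤ ((π ⊗ₘ P) (A ×ˢ Aᶜ)).toReal / ((π A).toReal * (π Aᶜ).toReal) :=
    hκstar ▸ csInf_le ⟨0, hS_nonneg⟩ ⟨A, hA, pos_iff_ne_zero.2 h0, hlt, rfl⟩
  have hpos : 0 < (π A).toReal * (π Aᶜ).toReal :=
    mul_pos (ENNReal.toReal_pos h0 (measure_ne_top _ _))
      (ENNReal.toReal_pos h1 (measure_ne_top _ _))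
  rw [le_div_iff₀ hpos] at hle
  rw [← ENNReal.toReal_le_toReal (by finiteness) (by finiteness), ENNReal.toReal_mul,
    ENNReal.toReal_mul, ENNReal.toReal_ofReal hκ]
  exact hle
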